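/- Let Λ be a normalized increasing Γ-semimodule of length s and let v be such that the axis u_{s+1} lies in I_v. Then R_q(Λ) is a circular interval for every q ≥ v. -/

import Mathlib

/-- The numerical semigroup `Γ = {a·n + b·m : a, b ∈ ℕ}`. -/
def Gam (n m : ℕ) : Set ℕ := {x | ∃ a b : ℕ, x = a * n + b * m}

/-- `Λ` is a `Γ`-semimodule: a nonempty subset of `ℕ` with `Λ + Γ ⊆ Λ`. -/
def IsSemimodule (n m : ℕ) (Λ : Set ℕ) : Prop :=
  Λ.Nonempty ∧ ∀ x ∈ Λ, ∀ g ∈ Gam n m, x + g ∈ Λ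

/-- The translate `c + Γ`. -/
def GamShift (n m c : ℕ) : Set ℕ := {x | ∃ g ∈ Gam n m, x = c + g}

/-- For a sequence `lam : ℕ → ℕ` (where `lam i` encodes the paper's `λ_{i-1}`),
`LamUnion n m lam j = (lam 0 + Γ) ∪ ⋯ ∪ (lam j + Γ)`; the paper's `Λ_k` is
`LamUnion n m lam (k+1)`. -/
def LamUnion (n m : ℕ) (lam : ℕ → ℕ) (j : ℕ) : Set ℕ :=
  {x | ∃ i ≤ j, x ∈ GamShift n m (lam i)}

/-- `lam 0, lam 1, …, lam (s+1)` encodes the (strictly increasing) basis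
`(λ_{-1}, λ_0, …, λ_s)` of `Λ`: each `λ_j ∉ Λ_{j-1}` for `0 ≤ j ≤ s` and `Λ = Λ_s`. -/
def IsBasisOf (n m : ℕ) (Λ : Set ℕ) (s : ℕ) (lam : ℕ → ℕ) : Prop :=
  (∀ i j, i < j → j ≤ s + 1 → lam i < lam j) ∧
  (∀ j, 1 ≤ j → j ≤ s + 1 → lam j ∉ LamUnion n m lam (j - 1)) ∧
  Λ = LamUnion n m lam (s + 1)

/-- The axes: `axisU 0 = λ_{-1}` and, in the paper's indexing,
`axisU i = min (Λ_{i-2} ∩ (λ_{i-1} + Γ))` for `1 ≤ i ≤ s+1`. -/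
noncomputable def axisU (n m : ℕ) (lam : ℕ → ℕ) : ℕ → ℕ
  | 0 => lam 0
  | i + 1 => sInf (LamUnion n m lam i ∩ GamShift n m (lam (i + 1)))

/-- The conductor of a subset of `ℕ`: the least `c` such that every `x ≥ c` belongs. -/
noncomputable def conductorOf (Λ : Set ℕ) : ℕ := sInf {c | ∀ x, c ≤ x → x ∈ Λ}

/-- The critical orders (shifted indexing: `critT i` is the paper's `t_{i-1}`):
`t_{-1} = n`, `t_0 = m`, and `t_i = t_{i-1} + u_i - λ_{i-1}` for `i ≥ 1`. -/
noncomputable def critT (n m : ℕ) (lam : ℕ → ℕ) : ℕ → ℕ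
  | 0 => n
  | 1 => m
  | i + 2 => critT n m lam (i + 1) + (axisU n m lam (i + 1) - lam (i + 1))

/-- The first limit `ℓ1 = min {p : n·p + λ_s ∈ Λ_{s-1}}`. -/
noncomputable def limit1 (n m s : ℕ) (lam : ℕ → ℕ) : ℕ :=
  sInf {p | n * p + lam (s + 1) ∈ LamUnion n m lam s}

/-- The second limit `ℓ2 = min {q : m·q + λ_s ∈ Λ_{s-1}}`. -/
noncomputable def limit2 (n m s : ℕ) (lam : ℕ → ℕ) : ℕ :=
  sInf {q | m * q + lam (s + 1) ∈ LamUnion n m lam s}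

/-- The top `q1`, determined by `λ_s + n·ℓ1 ∈ I_{q1}` where `I_q = [nq, n(q+1))`. -/
noncomputable def top1 (n m s : ℕ) (lam : ℕ → ℕ) : ℕ := (lam (s + 1) + n * limit1 n m s lam) / n

/-- The top `q2`, determined by `λ_s + m·ℓ2 ∈ I_{q2}`. -/
noncomputable def top2 (n m s : ℕ) (lam : ℕ → ℕ) : ℕ := (lam (s + 1) + m * limit2 n m s lam) / n

/-- The main top `Q_Λ = max (q1, q2)`. -/
noncomputable def mainTop (n m s : ℕ) (lam : ℕ → ℕ) : ℕ := max (top1 n m s lam) (top2 n m s lam)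

/-- The interval `I_q = {nq, nq+1, …, n(q+1)-1}`. -/
def Iq (n q : ℕ) : Set ℕ := {x | n * q ≤ x ∧ x < n * (q + 1)}

/-- The `q`-level set `R_q(S) = ξ(ρ(S ∩ I_q)) ⊆ {0,…,n-1}`, where `ρ : ℤ → ℤ/nℤ` and
`ξ : ℤ/nℤ → {0,…,n-1}` is determined by `ξ⁻¹(k) = ρ(k·m)`. -/
def Rlevel (n m : ℕ) (S : Set ℕ) (q : ℕ) : Set ℕ :=
  {r | r < n ∧ ∃ x ∈ S, x ∈ Iq n q ∧ r * m ≡ x [MOD n]}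

/-- The circular interval `<r,s>` inside `{0,…,n-1}`. -/
def CircInt (n r s : ℕ) : Set ℕ :=
  if r ≤ s then Set.Icc r s else Set.Icc r (n - 1) ∪ Set.Icc 0 s

/-- A subset of `{0,…,n-1}` is a circular interval if it equals some `<r,s>`. -/
def IsCircInt (n : ℕ) (A : Set ℕ) : Prop := ∃ r s, r < n ∧ s < n ∧ A = CircInt n r s

/-- The image in `{0,…,n-1}` of the integer interval `[a, a + l]` under reduction mod `n`. -/
def arc (n a l : ℕ) : Set ℕ := {r | ∃ k ≤ l, r = (a + k) % n}

theorem arc_congr {n a b : ℕ} (l : ℕ) (h : a ≡ b [MOD n]) : arc n a l = arc n b l := by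
  ext r
  have key : ∀ k, (a + k) % n = (b + k) % n := fun k => h.add_right k
  simp only [arc, Set.mem_ofPred_eq, key]

theorem mem_arc_iff_le {n a l r : ℕ} :
    r ∈ arc n a l ↔ ∃ x, a ≤ x ∧ x ≤ a + l ∧ r = x % n := by
  constructor
  · rintro ⟨k, hk, rfl⟩
    exact ⟨a + k, by omega, by omega, rfl⟩
  · rintro ⟨x, h1, h2, rfl⟩
    exact ⟨x - a, by omega, by congr 1; omega⟩

/-- Two arcs coming from intersecting integer intervals have an arc as their union. -/
theorem arc_union_of_eq {n a b k k' l l' : ℕ} (hk : k ≤ l) (hk' : k' ≤ l')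
    (h : a + k = b + k') :
    arc n a l ∪ arc n b l' = arc n (min a b) (max (a + l) (b + l') - min a b) := by
  ext r
  simp only [Set.mem_union, mem_arc_iff_le]
  constructor
  · rintro (⟨x, h1, h2, rfl⟩ | ⟨x, h1, h2, rfl⟩) <;> exact ⟨x, by omega, by omega, rfl⟩
  · rintro ⟨x, h1, h2, rfl⟩
    by_cases hx : a ≤ x ∧ x ≤ a + l
    · exact Or.inl ⟨x, hx.1, hx.2, rfl⟩
    · exact Or.inr ⟨x, by omega, by omega, rfl⟩

theorem exists_arc_union {n a b l l' : ℕ} (h : (arc n a l ∩ arc n b l').Nonempty) :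
    ∃ c d, arc n a l ∪ arc n b l' = arc n c d := by
  obtain ⟨r, ⟨k, hk, rfl⟩, k', hk', h⟩ := h
  have ha : a + n * ((b + k') / n) ≡ a [MOD n] := by simp [Nat.ModEq]
  have hb : b + n * ((a + k) / n) ≡ b [MOD n] := by simp [Nat.ModEq]
  rw [← arc_congr l ha, ← arc_congr l' hb]
  refine ⟨_, _, arc_union_of_eq hk hk' ?_⟩
  have h1 := Nat.div_add_mod (a + k) n
  have h2 := Nat.div_add_mod (b + k') n
  omega

theorem isCircInt_arc {n : ℕ} (hn : 0 < n) (a l : ℕ) : IsCircInt n (arc n a l) := by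
  rw [← arc_congr l (Nat.mod_modEq a n)]
  have ha := Nat.mod_lt a hn
  generalize a % n = a at ha
  by_cases hl : n ≤ l + 1
  · refine ⟨0, n - 1, hn, by omega, ?_⟩
    ext r
    simp only [CircInt, mem_arc_iff_le, Nat.zero_le, if_true, Set.mem_Icc, true_and]
    constructor
    · rintro ⟨x, -, -, rfl⟩
      have := Nat.mod_lt x hn
      omega
    · intro hr
      by_cases har : a ≤ r
      · exact ⟨r, har, by omega, (Nat.mod_eq_of_lt (by omega)).symm⟩
      · refine ⟨r + n, by omega, by omega, ?_⟩
        rw [Nat.add_mod_right, Nat.mod_eq_of_lt (by omega)]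
  by_cases hal : a + l < n
  · refine ⟨a, a + l, ha, hal, ?_⟩
    ext r
    simp only [CircInt, mem_arc_iff_le, Nat.le_add_right, if_true, Set.mem_Icc]
    constructor
    · rintro ⟨x, h1, h2, rfl⟩
      rw [Nat.mod_eq_of_lt (by omega)]
      exact ⟨h1, h2⟩
    · rintro ⟨h1, h2⟩
      exact ⟨r, h1, h2, (Nat.mod_eq_of_lt (by omega)).symm⟩
  · refine ⟨a, a + l - n, ha, by omega, ?_⟩
    ext r
    rw [CircInt, if_neg (by omega)]
    simp only [mem_arc_iff_le, Set.mem_union, Set.mem_Icc, Nat.zero_le, true_and]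
    constructor
    · rintro ⟨x, h1, h2, rfl⟩
      by_cases hx : x < n
      · rw [Nat.mod_eq_of_lt hx]
        omega
      · rw [Nat.mod_eq_sub_mod (by omega), Nat.mod_eq_of_lt (by omega)]
        omega
    · rintro (h | h)
      · exact ⟨r, h.1, by omega, (Nat.mod_eq_of_lt (by omega)).symm⟩
      · refine ⟨r + n, by omega, by omega, ?_⟩
        rw [Nat.add_mod_right, Nat.mod_eq_of_lt (by omega)]

theorem exists_mul_modEq {n m : ℕ} (hn : 0 < n) (hcop : Nat.Coprime n m) (c : ℕ) :
    ∃ t, t * m ≡ c [MOD n] := by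
  obtain ⟨t, ht⟩ := Nat.exists_mul_mod_eq_of_coprime c hcop.symm hn.ne'
  exact ⟨t, by rw [mul_comm]; exact ht.2⟩

/-- Adding a suitable multiple of `n` moves a number into a later interval `I_q`. -/
theorem exists_add_mul_mem_Iq {n q x : ℕ} (hn : 0 < n) (hx : x < n * (q + 1)) :
    ∃ α, x + α * n ∈ Iq n q := by
  have h1 : x / n ≤ q := Nat.lt_succ_iff.mp (Nat.div_lt_of_lt_mul hx)
  obtain ⟨d, hd⟩ := Nat.exists_eq_add_of_le h1
  have h2 := Nat.div_add_mod x n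
  have h3 := Nat.mod_lt x hn
  refine ⟨d, ?_, ?_⟩ <;> rw [hd] <;> linarith [Nat.zero_le (x % n)]

theorem add_mul_mem_GamShift {n m c x : ℕ} (hx : x ∈ GamShift n m c) (α : ℕ) :
    x + α * n ∈ GamShift n m c := by
  obtain ⟨g, ⟨a, b, rfl⟩, rfl⟩ := hx
  exact ⟨(a + α) * n + b * m, ⟨a + α, b, rfl⟩, by ring⟩

theorem add_mul_mem_LamUnion {n m j x : ℕ} {lam : ℕ → ℕ} (hx : x ∈ LamUnion n m lam j)
    (α : ℕ) : x + α * n ∈ LamUnion n m lam j := by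
  obtain ⟨i, hi, hx⟩ := hx
  exact ⟨i, hi, add_mul_mem_GamShift hx α⟩

theorem LamUnion_zero (n m : ℕ) (lam : ℕ → ℕ) :
    LamUnion n m lam 0 = GamShift n m (lam 0) := by
  ext x
  simp [LamUnion]

theorem LamUnion_succ (n m : ℕ) (lam : ℕ → ℕ) (j : ℕ) :
    LamUnion n m lam (j + 1) = LamUnion n m lam j ∪ GamShift n m (lam (j + 1)) := by
  ext x
  constructor
  · rintro ⟨i, hi, hx⟩
    rcases Nat.le_succ_iff.mp hi with h | rfl
    · exact Or.inl ⟨i, h, hx⟩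
    · exact Or.inr hx
  · rintro (⟨i, hi, hx⟩ | hx)
    · exact ⟨i, by omega, hx⟩
    · exact ⟨j + 1, le_rfl, hx⟩

theorem Rlevel_union (n m q : ℕ) (A B : Set ℕ) :
    Rlevel n m (A ∪ B) q = Rlevel n m A q ∪ Rlevel n m B q := by
  ext r
  simp only [Rlevel, Set.mem_union, Set.mem_ofPred_eq]
  grind

theorem exists_Rlevel_GamShift_eq_arc {n m : ℕ} (hn : 0 < n) (hm : 0 < m)
    (hcop : Nat.Coprime n m) {c q : ℕ} (hc : c < n * (q + 1)) :
    ∃ a l, Rlevel n m (GamShift n m c) q = arc n a l := by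
  obtain ⟨t, ht⟩ := exists_mul_modEq hn hcop c
  refine ⟨t, (n * (q + 1) - 1 - c) / m, ?_⟩
  ext r
  constructor
  · rintro ⟨hr, _, ⟨g, ⟨a, b, rfl⟩, rfl⟩, hI, hmod⟩
    refine ⟨b, (Nat.le_div_iff_mul_le hm).mpr ?_, ?_⟩
    · have := hI.2
      omega
    · have h1 : r * m ≡ (t + b) * m [MOD n] := by
        refine hmod.trans ?_
        have h2 : c + (a * n + b * m) ≡ c + b * m [MOD n] := by
          have : c + (a * n + b * m) = c + b * m + a * n := by ring
          rw [this]
          simp [Nat.ModEq]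
        rw [add_mul]
        exact h2.trans (ht.symm.add_right _)
      have h3 : r ≡ t + b [MOD n] := Nat.ModEq.cancel_right_of_coprime hcop h1
      rw [← h3, Nat.mod_eq_of_lt hr]
  · rintro ⟨b, hb, rfl⟩
    have hb' := (Nat.le_div_iff_mul_le hm).mp hb
    obtain ⟨α, hα⟩ := exists_add_mul_mem_Iq (x := c + b * m) hn (q := q) (by omega)
    refine ⟨Nat.mod_lt _ hn, _, ⟨α * n + b * m, ⟨α, b, rfl⟩, rfl⟩, ?_, ?_⟩
    · convert hα using 1
      ring
    · have h1 : (t + b) % n * m ≡ (t + b) * m [MOD n] := (Nat.mod_modEq _ _).mul_right m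
      refine h1.trans ?_
      rw [add_mul]
      refine (ht.add_right _).trans ?_
      have : c + (α * n + b * m) = c + b * m + α * n := by ring
      rw [this]
      simp [Nat.ModEq]

theorem axisU_succ_mem {n m : ℕ} (hn : 0 < n) (hcop : Nat.Coprime n m) {lam : ℕ → ℕ}
    (h0 : lam 0 = 0) (j : ℕ) :
    axisU n m lam (j + 1) ∈ LamUnion n m lam j ∩ GamShift n m (lam (j + 1)) := by
  refine Nat.sInf_mem ?_
  obtain ⟨b, hb⟩ := exists_mul_modEq hn hcop (lam (j + 1))
  have hle : b * m ≤ lam (j + 1) + b * m * n := by nlinarith [Nat.zero_le (b * m)]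
  have hmod : b * m ≡ lam (j + 1) + b * m * n [MOD n] := by
    simpa [Nat.ModEq] using hb
  obtain ⟨a, ha⟩ := (Nat.modEq_iff_dvd' hle).mp hmod
  refine ⟨lam (j + 1) + b * m * n, ⟨0, Nat.zero_le j, _, ⟨a, b, rfl⟩, ?_⟩,
    ⟨_, ⟨b * m, 0, rfl⟩, by ring⟩⟩
  rw [h0, mul_comm a n]
  omega

/-- Sets with a common element below `n(q+1)`, both stable under adding multiples of `n`, have
intersecting `q`-level sets. -/
theorem Rlevel_inter_nonempty {n m q u : ℕ} (hn : 0 < n) (hcop : Nat.Coprime n m) {A B : Set ℕ}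
    (hA : ∀ α, u + α * n ∈ A) (hB : ∀ α, u + α * n ∈ B) (hu : u < n * (q + 1)) :
    (Rlevel n m A q ∩ Rlevel n m B q).Nonempty := by
  obtain ⟨α, hα⟩ := exists_add_mul_mem_Iq hn hu
  obtain ⟨t, ht⟩ := exists_mul_modEq hn hcop (u + α * n)
  have ht' : t % n * m ≡ u + α * n [MOD n] := ((Nat.mod_modEq t n).mul_right m).trans ht
  exact ⟨t % n, ⟨Nat.mod_lt _ hn, _, hA α, hα, ht'⟩, ⟨Nat.mod_lt _ hn, _, hB α, hα, ht'⟩⟩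

theorem exists_Rlevel_LamUnion_eq_arc {n m : ℕ} (hn : 0 < n) (hm : 0 < m)
    (hcop : Nat.Coprime n m) {lam : ℕ → ℕ} (h0 : lam 0 = 0) (j : ℕ)
    (hinc : ∀ i < j, axisU n m lam i < lam (i + 1)) {q : ℕ}
    (hq : axisU n m lam j < n * (q + 1)) :
    ∃ a l, Rlevel n m (LamUnion n m lam j) q = arc n a l := by
  induction j with
  | zero =>
    rw [LamUnion_zero]
    exact exists_Rlevel_GamShift_eq_arc hn hm hcop hq
  | succ j ih =>
    obtain ⟨hu, hu'⟩ := axisU_succ_mem hn hcop h0 j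
    have hlam : lam (j + 1) ≤ axisU n m lam (j + 1) := by
      obtain ⟨g, -, hg⟩ := hu'
      omega
    have hj := hinc j (Nat.lt_succ_self j)
    have hint := Rlevel_inter_nonempty hn hcop (add_mul_mem_LamUnion hu)
      (add_mul_mem_GamShift hu') hq
    obtain ⟨a, l, h1⟩ := ih (fun i hi => hinc i (by omega)) (by omega)
    obtain ⟨b, l', h2⟩ := exists_Rlevel_GamShift_eq_arc hn hm hcop (c := lam (j + 1)) (q := q)
      (by omega)
    rw [h1, h2] at hint
    rw [LamUnion_succ, Rlevel_union, h1, h2]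
    exact exists_arc_union hint

/-- Let `Λ` be a normalized increasing `Γ`-semimodule of length `s` and `u_{s+1} ∈ I_v`.
Then `R_q(Λ)` is a circular interval for every `q ≥ v`. -/
theorem increasing_level_sets_circular (n m : ℕ) (hn : 2 ≤ n) (hnm : n < m)
    (hcop : Nat.Coprime n m) (Λ : Set ℕ) (s : ℕ) (lam : ℕ → ℕ)
    (hΛ : IsSemimodule n m Λ) (hb : IsBasisOf n m Λ s lam) (h0 : lam 0 = 0)
    (hinc : ∀ i, i ≤ s → axisU n m lam i < lam (i + 1))
    (v : ℕ) (hv : axisU n m lam (s + 1) ∈ Iq n v) :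
    ∀ q, v ≤ q → IsCircInt n (Rlevel n m Λ q) := by
  intro q hq
  have hn0 : 0 < n := by omega
  have hlt : axisU n m lam (s + 1) < n * (q + 1) :=
    hv.2.trans_le (Nat.mul_le_mul_left n (by omega))
  obtain ⟨a, l, h⟩ := exists_Rlevel_LamUnion_eq_arc hn0 (by omega) hcop h0 (s + 1)
    (fun i hi => hinc i (by omega)) hlt
  rw [hb.2.2, h]
  exact isCircInt_arc hn0 a l
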